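/- Let Λ ∈ ℝ³ and let W ∈ L⁴(B₁) ∩ W^{1,2}_loc(B₁) be a smooth solution of -ΔW = -∇×((∇×W)×Λ) in B₁. Then for every m ∈ ℕ and every cutoff ζ ∈ C_c^∞(B₁) with 0 ≤ ζ ≤ 1, there is a constant c (depending on ζ and m but not on Λ, W) such that ∫_{B₁} ζ^{2m} |∇W|² dx ≤ c (1 + |Λ|²) ∫_{B₁} ζ^{2m-2} |W - W_{B₁}|² dx. -/

import Mathlib

open MeasureTheory Metric Filter
open scoped Topology ENNReal

noncomputable section

abbrev E3 := EuclideanSpace ℝ (Fin 3)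

/-- partial derivative of a scalar field in direction `j` -/
noncomputable def pd (f : E3 → ℝ) (j : Fin 3) (x : E3) : ℝ :=
  fderiv ℝ f x (EuclideanSpace.single j 1)

/-- the curl of a vector field on ℝ³ -/
noncomputable def curl (u : E3 → E3) (x : E3) : E3 :=
  (WithLp.equiv 2 (Fin 3 → ℝ)).symm fun i =>
    pd (fun y => u y (i + 2)) (i + 1) x - pd (fun y => u y (i + 1)) (i + 2) x

/-- the cross product on ℝ³ -/
noncomputable def cross (a b : E3) : E3 :=
  (WithLp.equiv 2 (Fin 3 → ℝ)).symm fun i =>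
    a (i + 1) * b (i + 2) - a (i + 2) * b (i + 1)

/-- euclidean dot product -/
noncomputable def dot (a b : E3) : ℝ := ∑ i, a i * b i

/-- the gradient of a scalar field -/
noncomputable def gradv (f : E3 → ℝ) (x : E3) : E3 :=
  (WithLp.equiv 2 (Fin 3 → ℝ)).symm fun j => pd f j x

/-- the Laplacian of a scalar field -/
noncomputable def lap (f : E3 → ℝ) (x : E3) : ℝ := ∑ j, pd (pd f j) j x

/-- `|∇B|²` for a vector field `B` -/
noncomputable def gradNormSq (B : E3 → E3) (x : E3) : ℝ :=
  ∑ i, ∑ j, (pd (fun y => B y i) j x) ^ 2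

/-- `∇B : ∇Φ` for vector fields -/
noncomputable def gradDot (B Φ : E3 → E3) (x : E3) : ℝ :=
  ∑ i, ∑ j, pd (fun y => B y i) j x * pd (fun y => Φ y i) j x

/-- the mean value of `B` over the ball `B_r(x₀)` -/
noncomputable def mean (B : E3 → E3) (r : ℝ) (x₀ : E3) : E3 :=
  ⨍ x in ball x₀ r, B x

/-- scalar test functions supported in `Ω` -/
def TestR (Ω : Set E3) (φ : E3 → ℝ) : Prop :=
  ContDiff ℝ (⊤ : ℕ∞) φ ∧ HasCompactSupport φ ∧ tsupport φ ⊆ Ω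

/-- vector test functions supported in `Ω` -/
def TestV (Ω : Set E3) (Φ : E3 → E3) : Prop :=
  ContDiff ℝ (⊤ : ℕ∞) Φ ∧ HasCompactSupport Φ ∧ tsupport Φ ⊆ Ω

/-- weak solution of `-ΔB = -∇×((∇×B)×B) + ∇×F` in `Ω` -/
def WeakSolMaxwell (Ω : Set E3) (B F : E3 → E3) : Prop :=
  ∀ Φ : E3 → E3, TestV Ω Φ →
    ∫ x in Ω, gradDot B Φ x =
      - ∫ x in Ω, dot (cross (curl B x) (B x)) (curl Φ x)
      + ∫ x in Ω, dot (F x) (curl Φ x)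

/-- the local energy inequality for the system `-ΔB = -∇×((∇×B)×B) + ∇×F` -/
def LocalEnergyIneq (Ω : Set E3) (B F : E3 → E3) : Prop :=
  ∀ φ : E3 → ℝ, TestR Ω φ → (∀ x, 0 ≤ φ x) →
    ∫ x in Ω, φ x * gradNormSq B x ≤
      (1 / 2) * ∫ x in Ω, lap φ x * ‖B x‖ ^ 2
      - ∫ x in Ω, dot (cross (curl B x) (B x)) (cross (B x) (gradv φ x))
      + ∫ x in Ω, (φ x * dot (F x) (curl B x) + dot (F x) (cross (B x) (gradv φ x)))

/-- `W^{1,2}_loc(Ω)` in representative form -/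
def W12loc (Ω : Set E3) (B : E3 → E3) : Prop :=
  LocallyIntegrableOn B Ω volume ∧
    LocallyIntegrableOn (fun x => gradNormSq B x) Ω volume

/-- `L²_loc(Ω)` -/
def L2loc (Ω : Set E3) (F : E3 → E3) : Prop :=
  LocallyIntegrableOn (fun x => ‖F x‖ ^ 2) Ω volume

end
/-- `W^{1,2}` test functions with compact support in `Ω` (represented by `C¹` fields). -/
def TestV1 (Ω : Set E3) (Φ : E3 → E3) : Prop :=
  ContDiff ℝ 1 Φ ∧ HasCompactSupport Φ ∧ tsupport Φ ⊆ Ω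

/-- weak solution of the linear system `-ΔW = -∇×((∇×W)×Λ)` in the unit ball -/
def WeakSolLin (Λ : E3) (W : E3 → E3) : Prop :=
  ∀ Φ : E3 → E3, TestV1 (ball (0 : E3) 1) Φ →
    ∫ x in ball (0 : E3) 1, gradDot W Φ x =
      - ∫ x in ball (0 : E3) 1, dot (cross (curl W x) Λ) (curl Φ x)

/-- `W ∈ L⁴(B₁) ∩ W^{1,2}_loc(B₁)` in representative form -/
def L4W12loc (W : E3 → E3) : Prop :=
  IntegrableOn (fun x => ‖W x‖ ^ 4) (ball (0 : E3) 1) volume ∧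
    LocallyIntegrableOn W (ball (0 : E3) 1) volume ∧
    LocallyIntegrableOn (fun x => gradNormSq W x) (ball (0 : E3) 1) volume

lemma cacc_integrable {η g : E3 → ℝ} (hη : Continuous η) (hc : HasCompactSupport η)
    (hs : tsupport η ⊆ ball (0 : E3) 1) (hg : ContinuousOn g (ball (0 : E3) 1)) :
    Integrable (fun x => η x * g x) := by
  have h1 : Continuous (fun x => η x * g x) := by
    apply continuous_of_tsupport
    intro x hx
    have hx' : x ∈ tsupport η := tsupport_mul_subset_left hx
    exact hη.continuousAt.mul (hg.continuousAt (isOpen_ball.mem_nhds (hs hx')))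
  exact h1.integrable_of_hasCompactSupport (hc.mul_right)

lemma cacc_flux {η g : E3 → ℝ} (hη : ContDiff ℝ 1 η) (hc : HasCompactSupport η)
    (hs : tsupport η ⊆ ball (0 : E3) 1) (hg : ContDiffOn ℝ 1 g (ball (0 : E3) 1)) (j : Fin 3) :
    Integrable (pd (fun x => η x * g x) j) ∧
      ∫ x in ball (0 : E3) 1, pd (fun x => η x * g x) j x = 0 := by
  have hts : tsupport (fun x => η x * g x) ⊆ tsupport η := tsupport_mul_subset_left
  have h1 : ContDiff ℝ 1 (fun x => η x * g x) := by
    rw [contDiff_iff_contDiffAt]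
    intro x
    by_cases hx : x ∈ tsupport (fun x => η x * g x)
    swap
    · have h0 : (fun x => η x * g x) =ᶠ[𝓝 x] fun _ => (0 : ℝ) :=
        notMem_tsupport_iff_eventuallyEq.1 hx
      exact contDiffAt_const.congr_of_eventuallyEq h0
    exact hη.contDiffAt.mul (hg.contDiffAt (isOpen_ball.mem_nhds (hs (hts hx))))
  have hcs : HasCompactSupport (fun x => η x * g x) := hc.mul_right
  set f := fun x => η x * g x with hf
  have hfc : Continuous (pd f j) := by
    have := h1.continuous_fderiv (by norm_num)
    unfold pd
    fun_prop
  have hpc : HasCompactSupport (pd f j) := hcs.fderiv_apply ℝ _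
  have hpi : Integrable (pd f j) := hfc.integrable_of_hasCompactSupport hpc
  refine ⟨hpi, ?_⟩
  have hsub : tsupport (pd f j) ⊆ tsupport f := tsupport_fderiv_apply_subset ℝ _
  rw [setIntegral_eq_integral_of_forall_compl_eq_zero]
  · have := integral_mul_fderiv_eq_neg_fderiv_mul_of_integrable (μ := volume) (𝕜 := ℝ)
      (f := fun _ : E3 => (1 : ℝ)) (g := f) (v := EuclideanSpace.single j 1)
      (by simp) (by simp only [one_mul]; exact hpi)
      (by simpa using h1.continuous.integrable_of_hasCompactSupport hcs)
      (by simp) (fun x _ => h1.differentiable (by norm_num) x)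
    simpa [pd] using this
  · intro x hx
    by_contra hne
    exact hx (hs (hts (hsub (subset_tsupport _ hne))))

lemma cacc_pd_mul {f g : E3 → ℝ} {x : E3} (j : Fin 3) (hf : DifferentiableAt ℝ f x)
    (hg : DifferentiableAt ℝ g x) :
    pd (fun y => f y * g y) j x = pd f j x * g x + f x * pd g j x := by
  unfold pd
  rw [fderiv_fun_mul hf hg]
  simp
  ring

lemma cacc_pd_smooth {f : E3 → ℝ} (hf : ContDiffOn ℝ (⊤ : ℕ∞) f (ball (0 : E3) 1)) (j : Fin 3) :
    ContDiffOn ℝ (⊤ : ℕ∞) (pd f j) (ball (0 : E3) 1) := by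
  have := hf.fderiv_of_isOpen isOpen_ball (m := ((⊤ : ℕ∞) : WithTop ℕ∞)) (by simp)
  unfold pd
  exact this.clm_apply contDiffOn_const

/-- coefficient functions of the flux matrix -/
noncomputable def caccA (W : E3 → E3) (Λ : E3) (i j : Fin 3) (y : E3) : ℝ :=
  pd (fun z => W z i) j y - (if j = i + 1 then 1 else 0) * cross (curl W y) Λ (i + 2)
    + (if j = i + 2 then 1 else 0) * cross (curl W y) Λ (i + 1)

lemma cacc_G_smooth {W : E3 → E3} (hW : ContDiffOn ℝ (⊤ : ℕ∞) W (ball (0 : E3) 1)) (Λ : E3)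
    (i : Fin 3) : ContDiffOn ℝ (⊤ : ℕ∞) (fun y => cross (curl W y) Λ i) (ball (0 : E3) 1) := by
  have hWi : ∀ i : Fin 3, ContDiffOn ℝ (⊤ : ℕ∞) (fun y => W y i) (ball (0 : E3) 1) :=
    fun i => contDiffOn_euclidean.1 hW i
  have hp := fun i j => cacc_pd_smooth (hWi i) j
  have : (fun y => cross (curl W y) Λ i) = fun y =>
      (pd (fun z => W z (i + 1 + 2)) (i + 1 + 1) y - pd (fun z => W z (i + 1 + 1)) (i + 1 + 2) y)
        * Λ (i + 2) -
      (pd (fun z => W z (i + 2 + 2)) (i + 2 + 1) y - pd (fun z => W z (i + 2 + 1)) (i + 2 + 2) y)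
        * Λ (i + 1) := rfl
  rw [this]
  exact ((((hp _ _).sub (hp _ _)).mul contDiffOn_const).sub
    (((hp _ _).sub (hp _ _)).mul contDiffOn_const))

lemma cacc_A_smooth {W : E3 → E3} (hW : ContDiffOn ℝ (⊤ : ℕ∞) W (ball (0 : E3) 1)) (Λ : E3)
    (i j : Fin 3) : ContDiffOn ℝ (⊤ : ℕ∞) (caccA W Λ i j) (ball (0 : E3) 1) := by
  have hWi : ContDiffOn ℝ (⊤ : ℕ∞) (fun y => W y i) (ball (0 : E3) 1) :=
    contDiffOn_euclidean.1 hW i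
  exact ((cacc_pd_smooth hWi j).sub (contDiffOn_const.mul (cacc_G_smooth hW Λ _))).add
    (contDiffOn_const.mul (cacc_G_smooth hW Λ _))

lemma cacc_A_div {W : E3 → E3} (hW : ContDiffOn ℝ (⊤ : ℕ∞) W (ball (0 : E3) 1)) (Λ : E3)
    {x : E3} (hx : x ∈ ball (0 : E3) 1) (i : Fin 3)
    (h : lap (fun y => W y i) x = curl (fun y => cross (curl W y) Λ) x i) :
    ∑ j, pd (caccA W Λ i j) j x = 0 := by
  have hn := isOpen_ball.mem_nhds hx
  have hp : ∀ j, DifferentiableAt ℝ (pd (fun y => W y i) j) x := fun j =>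
    ((cacc_pd_smooth (contDiffOn_euclidean.1 hW i) j).contDiffAt hn).differentiableAt (by simp)
  have hG : ∀ k, DifferentiableAt ℝ (fun y => cross (curl W y) Λ k) x := fun k =>
    ((cacc_G_smooth hW Λ k).contDiffAt hn).differentiableAt (by simp)
  have key : ∀ j, pd (caccA W Λ i j) j x = pd (pd (fun y => W y i) j) j x
      - (if j = i + 1 then 1 else 0) * pd (fun y => cross (curl W y) Λ (i + 2)) j x
      + (if j = i + 2 then 1 else 0) * pd (fun y => cross (curl W y) Λ (i + 1)) j x := by
    intro j
    have := (((hp j).hasFDerivAt.sub ((hG (i + 2)).hasFDerivAt.const_mul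
      (if j = i + 1 then (1 : ℝ) else 0))).add ((hG (i + 1)).hasFDerivAt.const_mul
      (if j = i + 2 then (1 : ℝ) else 0))).fderiv
    have h2 : fderiv ℝ (caccA W Λ i j) x = _ := this
    unfold pd at h2 ⊢
    rw [h2]
    split_ifs <;> simp
  have h3 : curl (fun y => cross (curl W y) Λ) x i =
    pd (fun y => cross (curl W y) Λ (i + 2)) (i + 1) x
      - pd (fun y => cross (curl W y) Λ (i + 1)) (i + 2) x := rfl
  simp only [key, Finset.sum_add_distrib, Finset.sum_sub_distrib]
  rw [h3, lap] at h
  simp [h]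

set_option maxHeartbeats 2000000 in
lemma cacc_alg (p : Fin 3 → Fin 3 → ℝ) (l : Fin 3 → ℝ) (G : Fin 3 → ℝ) (A : Fin 3 → Fin 3 → ℝ)
    (hG : ∀ i, G i = (p (i + 1 + 2) (i + 1 + 1) - p (i + 1 + 1) (i + 1 + 2)) * l (i + 2)
      - (p (i + 2 + 2) (i + 2 + 1) - p (i + 2 + 1) (i + 2 + 2)) * l (i + 1))
    (hA : ∀ i j, A i j = p i j - (if j = i + 1 then 1 else 0) * G (i + 2)
      + (if j = i + 2 then 1 else 0) * G (i + 1)) :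
    (∑ i, ∑ j, p i j * A i j = ∑ i, ∑ j, p i j ^ 2) ∧
    (∑ i, ∑ j, A i j ^ 2 ≤ 8 * (1 + ∑ i, l i ^ 2) * ∑ i, ∑ j, p i j ^ 2) := by
  have e0 := hG 0
  have e1 := hG 1
  have e2 := hG 2
  simp only [Fin.isValue, zero_add, show (1 : Fin 3) + 1 = 2 from rfl,
    show (1 : Fin 3) + 2 = 0 from rfl, show (2 : Fin 3) + 1 = 0 from rfl,
    show (2 : Fin 3) + 2 = 1 from rfl] at e0 e1 e2
  simp only [hA, Fin.sum_univ_three]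
  simp only [Fin.isValue, zero_add, show (1 : Fin 3) + 1 = 2 from rfl,
    show (1 : Fin 3) + 2 = 0 from rfl, show (2 : Fin 3) + 1 = 0 from rfl,
    show (2 : Fin 3) + 2 = 1 from rfl, Fin.reduceEq, if_true, if_false, one_mul, zero_mul,
    sub_zero, add_zero]
  constructor
  · rw [e0, e1, e2]; ring
  · set c0 := p 2 1 - p 1 2 with hc0
    set c1 := p 0 2 - p 2 0 with hc1
    set c2 := p 1 0 - p 0 1 with hc2
    have hP : c0 ^ 2 + c1 ^ 2 + c2 ^ 2 ≤ 2 * (p 0 0 ^ 2 + p 0 1 ^ 2 + p 0 2 ^ 2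
        + (p 1 0 ^ 2 + p 1 1 ^ 2 + p 1 2 ^ 2) + (p 2 0 ^ 2 + p 2 1 ^ 2 + p 2 2 ^ 2)) := by
      rw [hc0, hc1, hc2]
      nlinarith [sq_nonneg (p 2 1 + p 1 2), sq_nonneg (p 0 2 + p 2 0), sq_nonneg (p 1 0 + p 0 1),
        sq_nonneg (p 0 0), sq_nonneg (p 1 1), sq_nonneg (p 2 2)]
    have hGG : G 0 ^ 2 + G 1 ^ 2 + G 2 ^ 2 ≤
        (c0 ^ 2 + c1 ^ 2 + c2 ^ 2) * (l 0 ^ 2 + l 1 ^ 2 + l 2 ^ 2) := by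
      rw [e0, e1, e2]
      nlinarith [sq_nonneg (c0 * l 0 + c1 * l 1 + c2 * l 2)]
    have hL : 0 ≤ l 0 ^ 2 + l 1 ^ 2 + l 2 ^ 2 := by positivity
    have hGP := hGG.trans (mul_le_mul_of_nonneg_right hP hL)
    have hA2 : ∀ a b : ℝ, (a - b) ^ 2 ≤ 2 * a ^ 2 + 2 * b ^ 2 := fun a b => by
      nlinarith [sq_nonneg (a + b)]
    have hA3 : ∀ a b : ℝ, (a + b) ^ 2 ≤ 2 * a ^ 2 + 2 * b ^ 2 := fun a b => by
      nlinarith [sq_nonneg (a - b)]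
    have hPn : 0 ≤ p 0 0 ^ 2 + p 0 1 ^ 2 + p 0 2 ^ 2
        + (p 1 0 ^ 2 + p 1 1 ^ 2 + p 1 2 ^ 2) + (p 2 0 ^ 2 + p 2 1 ^ 2 + p 2 2 ^ 2) := by
      positivity
    have hfin : 8 * (1 + (l 0 ^ 2 + l 1 ^ 2 + l 2 ^ 2)) * (p 0 0 ^ 2 + p 0 1 ^ 2 + p 0 2 ^ 2
        + (p 1 0 ^ 2 + p 1 1 ^ 2 + p 1 2 ^ 2) + (p 2 0 ^ 2 + p 2 1 ^ 2 + p 2 2 ^ 2)) =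
        8 * (p 0 0 ^ 2 + p 0 1 ^ 2 + p 0 2 ^ 2
        + (p 1 0 ^ 2 + p 1 1 ^ 2 + p 1 2 ^ 2) + (p 2 0 ^ 2 + p 2 1 ^ 2 + p 2 2 ^ 2)) +
        4 * (2 * (p 0 0 ^ 2 + p 0 1 ^ 2 + p 0 2 ^ 2
        + (p 1 0 ^ 2 + p 1 1 ^ 2 + p 1 2 ^ 2) + (p 2 0 ^ 2 + p 2 1 ^ 2 + p 2 2 ^ 2)) *
          (l 0 ^ 2 + l 1 ^ 2 + l 2 ^ 2)) := by ring
    rw [hfin]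
    refine le_trans ?_ (add_le_add_right (mul_le_mul_of_nonneg_left hGP (by norm_num)) _)
    linarith [hA2 (p 0 1) (G 2), hA3 (p 0 2) (G 1), hA2 (p 1 2) (G 0), hA3 (p 1 0) (G 2),
      hA2 (p 2 0) (G 1), hA3 (p 2 1) (G 0), sq_nonneg (p 0 0), sq_nonneg (p 1 1),
      sq_nonneg (p 2 2)]

lemma cacc_young (p A : Fin 3 → Fin 3 → ℝ) (z v : Fin 3 → ℝ) (s μ K L : ℝ) (k : ℕ)
    (hs : 0 ≤ s) (hL : 0 ≤ L) (hz : ∀ j, z j ^ 2 ≤ K ^ 2)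
    (h1 : ∑ i, ∑ j, p i j * A i j = ∑ i, ∑ j, p i j ^ 2)
    (h2 : ∑ i, ∑ j, A i j ^ 2 ≤ 8 * (1 + L) * ∑ i, ∑ j, p i j ^ 2) :
    s ^ (2 * k + 2) * ∑ i, ∑ j, p i j ^ 2 ≤
      2 * ∑ i, ∑ j, (2 * μ * s ^ (2 * k + 1) * z j * v i * A i j + s ^ (2 * k + 2) * (p i j * A i j))
      + (96 * μ ^ 2 * K ^ 2) * (1 + L) * (s ^ (2 * k) * ∑ i, v i ^ 2) := by
  have hsk : 0 ≤ s ^ (2 * k) := by positivity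
  have hterm : ∀ i j, -(2 * μ * s ^ (2 * k + 1) * z j * v i * A i j) ≤
      s ^ (2 * k) * (s ^ 2 * A i j ^ 2 / (16 * (1 + L)) + 16 * (1 + L) * μ ^ 2 * (K ^ 2 * v i ^ 2)) := by
    intro i j
    have e : -(2 * μ * s ^ (2 * k + 1) * z j * v i * A i j) =
      s ^ (2 * k) * (-(2 * μ * s * z j * v i * A i j)) := by ring
    rw [e]
    apply mul_le_mul_of_nonneg_left _ hsk
    have hy : -(2 * μ * s * z j * v i * A i j) ≤
        s ^ 2 * A i j ^ 2 / (16 * (1 + L)) + 16 * (1 + L) * μ ^ 2 * (z j ^ 2 * v i ^ 2) := by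
      have hpos : 0 < 16 * (1 + L) := by positivity
      have := div_nonneg (sq_nonneg (s * A i j + 16 * (1 + L) * (μ * z j * v i))) hpos.le
      have e2 : (s * A i j + 16 * (1 + L) * (μ * z j * v i)) ^ 2 / (16 * (1 + L)) =
          s ^ 2 * A i j ^ 2 / (16 * (1 + L)) + 16 * (1 + L) * μ ^ 2 * (z j ^ 2 * v i ^ 2)
          + 2 * μ * s * z j * v i * A i j := by
        field_simp
        ring
      linarith
    refine hy.trans ?_
    have := mul_le_mul_of_nonneg_right (hz j) (sq_nonneg (v i))
    gcongr
  have hsum := Finset.sum_le_sum fun i (_ : i ∈ Finset.univ) =>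
    Finset.sum_le_sum fun j (_ : j ∈ (Finset.univ : Finset (Fin 3))) => hterm i j
  have hr : ∑ i, ∑ j : Fin 3, s ^ (2 * k) * (s ^ 2 * A i j ^ 2 / (16 * (1 + L))
      + 16 * (1 + L) * μ ^ 2 * (K ^ 2 * v i ^ 2)) =
      s ^ (2 * k + 2) / (16 * (1 + L)) * (∑ i, ∑ j, A i j ^ 2) +
      48 * μ ^ 2 * K ^ 2 * (1 + L) * (s ^ (2 * k) * ∑ i, v i ^ 2) := by
    simp only [Fin.sum_univ_three]
    ring
  rw [hr] at hsum
  have hA : s ^ (2 * k + 2) / (16 * (1 + L)) * (∑ i, ∑ j, A i j ^ 2) ≤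
      s ^ (2 * k + 2) / 2 * ∑ i, ∑ j, p i j ^ 2 := by
    calc _ ≤ s ^ (2 * k + 2) / (16 * (1 + L)) * (8 * (1 + L) * ∑ i, ∑ j, p i j ^ 2) := by
          gcongr
      _ = _ := by field_simp; ring
  have e3 : ∑ i, ∑ j, (2 * μ * s ^ (2 * k + 1) * z j * v i * A i j
      + s ^ (2 * k + 2) * (p i j * A i j)) =
      -(∑ i, ∑ j, -(2 * μ * s ^ (2 * k + 1) * z j * v i * A i j))
      + s ^ (2 * k + 2) * ∑ i, ∑ j, p i j ^ 2 := by
    rw [← h1]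
    simp only [Finset.sum_add_distrib, Finset.mul_sum, Finset.sum_neg_distrib, neg_neg]
  rw [e3]
  linarith

/-- Caccioppoli estimate (4.4) with cutoff powers. -/
theorem caccioppoli_linear (m : ℕ) (hm : 1 ≤ m) (ζ : E3 → ℝ)
    (hζ : TestR (ball (0 : E3) 1) ζ) (hζ0 : ∀ x, 0 ≤ ζ x) (hζ1 : ∀ x, ζ x ≤ 1) :
    ∃ c : ℝ, 0 < c ∧ ∀ (Λ : E3) (W : E3 → E3),
      L4W12loc W → ContDiffOn ℝ (⊤ : ℕ∞) W (ball (0 : E3) 1) →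
      (∀ x ∈ ball (0 : E3) 1, ∀ i : Fin 3,
        lap (fun y => W y i) x = curl (fun y => cross (curl W y) Λ) x i) →
      ∫ x in ball (0 : E3) 1, ζ x ^ (2 * m) * gradNormSq W x ≤
        c * (1 + ‖Λ‖ ^ 2) *
          ∫ x in ball (0 : E3) 1, ζ x ^ (2 * m - 2) * ‖W x - mean W 1 0‖ ^ 2 := by
  obtain ⟨hζs, hζc, hζt⟩ := hζ
  obtain ⟨k, rfl⟩ : ∃ k, m = k + 1 := ⟨m - 1, by omega⟩
  obtain ⟨K, hK⟩ : ∃ K, ∀ x, ‖fderiv ℝ ζ x‖ ≤ K :=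
    (hζc.fderiv ℝ).exists_bound_of_continuous (hζs.continuous_fderiv (by simp))
  have hz : ∀ x j, pd ζ j x ^ 2 ≤ K ^ 2 := by
    intro x j
    have h1 : ‖pd ζ j x‖ ≤ ‖fderiv ℝ ζ x‖ * ‖(EuclideanSpace.single j 1 : E3)‖ :=
      ContinuousLinearMap.le_opNorm _ _
    rw [EuclideanSpace.norm_single, norm_one, mul_one, Real.norm_eq_abs] at h1
    exact sq_le_sq.2 ((h1.trans (hK x)).trans (le_abs_self K))
  refine ⟨96 * ((k : ℝ) + 1) ^ 2 * K ^ 2 + 1, by positivity, ?_⟩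
  intro Λ W hL hW hpde
  generalize mean W 1 0 = b
  have e1 : 2 * (k + 1) = 2 * k + 2 := by ring
  have e2 : 2 * (k + 1) - 2 = 2 * k := by omega
  rw [e2, e1]
  have hWi : ∀ i : Fin 3, ContDiffOn ℝ (⊤ : ℕ∞) (fun y => W y i) (ball (0 : E3) 1) :=
    fun i => contDiffOn_euclidean.1 hW i
  -- the cutoff
  have hηs : ContDiff ℝ (⊤ : ℕ∞) (fun x => ζ x ^ (2 * k + 2)) := hζs.pow _
  have hηsub : tsupport (fun x => ζ x ^ (2 * k + 2)) ⊆ tsupport ζ := by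
    apply closure_mono
    intro x hx hx0
    apply hx
    simp [hx0]
  have hηc : HasCompactSupport (fun x => ζ x ^ (2 * k + 2)) :=
    hζc.mono' ((subset_tsupport _).trans hηsub)
  have hηt := hηsub.trans hζt
  -- the fluxes
  have hVA : ∀ i j, ContDiffOn ℝ (⊤ : ℕ∞) (fun y => (W y i - b i) * caccA W Λ i j y)
      (ball (0 : E3) 1) := fun i j =>
    ((hWi i).sub contDiffOn_const).mul (cacc_A_smooth hW Λ i j)
  have hflux := fun i j => cacc_flux (hηs.of_le (by simp)) hηc hηt ((hVA i j).of_le (by simp)) j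
  set D : E3 → ℝ := fun x => ∑ i, ∑ j,
    pd (fun y => ζ y ^ (2 * k + 2) * ((W y i - b i) * caccA W Λ i j y)) j x with hD
  have hDi : IntegrableOn D (ball (0 : E3) 1) := by
    apply Integrable.integrableOn
    exact integrable_finsetSum _ fun i _ => integrable_finsetSum _ fun j _ => (hflux i j).1
  have hD0 : ∫ x in ball (0 : E3) 1, D x = 0 := by
    rw [hD, integral_finsetSum _ fun i _ => integrable_finsetSum _
      fun j _ => (hflux i j).1.integrableOn]
    refine Finset.sum_eq_zero fun i _ => ?_
    rw [integral_finsetSum _ fun j _ => (hflux i j).1.integrableOn]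
    exact Finset.sum_eq_zero fun j _ => (hflux i j).2
  -- integrability
  have hI1 : IntegrableOn (fun x => ζ x ^ (2 * k + 2) * gradNormSq W x) (ball (0 : E3) 1) := by
    apply Integrable.integrableOn
    apply cacc_integrable hηs.continuous hηc hηt
    unfold gradNormSq
    exact continuousOn_finset_sum _ fun i _ => continuousOn_finset_sum _ fun j _ =>
      (cacc_pd_smooth (hWi i) j).continuousOn.pow 2
  have hI2 : IntegrableOn (fun x => ζ x ^ (2 * k) * ‖W x - b‖ ^ 2) (ball (0 : E3) 1) := by
    have hfin : IsFiniteMeasure (volume.restrict (ball (0 : E3) 1)) :=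
      ⟨by simpa using measure_ball_lt_top⟩
    have hdom : IntegrableOn (fun x => ‖W x‖ ^ 4 + (1 + 2 * ‖b‖ ^ 2)) (ball (0 : E3) 1) :=
      Integrable.add hL.1 (integrable_const _)
    refine Integrable.mono' hdom ?_ ?_
    · refine ContinuousOn.aestronglyMeasurable ?_ measurableSet_ball
      exact (hζs.continuous.continuousOn.pow _).mul
        ((hW.continuousOn.sub continuousOn_const).norm.pow 2)
    · refine Eventually.of_forall fun x => ?_
      have h0 : 0 ≤ ζ x ^ (2 * k) := pow_nonneg (hζ0 x) _
      have h1 : ζ x ^ (2 * k) ≤ 1 := pow_le_one₀ (hζ0 x) (hζ1 x)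
      rw [Real.norm_of_nonneg (by positivity)]
      have h2 : ‖W x - b‖ ≤ ‖W x‖ + ‖b‖ := norm_sub_le _ _
      have h3 : ‖W x - b‖ ^ 2 ≤ (‖W x‖ + ‖b‖) ^ 2 := by gcongr
      have h4 : ζ x ^ (2 * k) * ‖W x - b‖ ^ 2 ≤ 1 * ‖W x - b‖ ^ 2 := by gcongr
      nlinarith [sq_nonneg (‖W x‖ - ‖b‖), sq_nonneg (‖W x‖ ^ 2 - 1)]
  -- pointwise inequality
  have hpt : ∀ x ∈ ball (0 : E3) 1, ζ x ^ (2 * k + 2) * gradNormSq W x ≤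
      2 * D x + (96 * ((k : ℝ) + 1) ^ 2 * K ^ 2) * (1 + ‖Λ‖ ^ 2)
        * (ζ x ^ (2 * k) * ‖W x - b‖ ^ 2) := by
    intro x hx
    have hn := isOpen_ball.mem_nhds hx
    have halg := cacc_alg (fun i j => pd (fun y => W y i) j x) (fun i => Λ i)
      (fun i => cross (curl W x) Λ i) (fun i j => caccA W Λ i j x) (fun i => rfl)
      (fun i j => rfl)
    have hΛ : ‖Λ‖ ^ 2 = ∑ i, Λ i ^ 2 := by simp [EuclideanSpace.norm_sq_eq]
    have hV : ‖W x - b‖ ^ 2 = ∑ i, (W x i - b i) ^ 2 := by simp [EuclideanSpace.norm_sq_eq]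
    have hy := cacc_young (fun i j => pd (fun y => W y i) j x) (fun i j => caccA W Λ i j x)
      (fun j => pd ζ j x) (fun i => W x i - b i) (ζ x) ((k : ℝ) + 1) K (∑ i, Λ i ^ 2) k (hζ0 x)
      (by positivity) (hz x) halg.1 halg.2
    have hDx : D x = ∑ i, ∑ j, (2 * ((k : ℝ) + 1) * ζ x ^ (2 * k + 1) * pd ζ j x
        * (W x i - b i) * caccA W Λ i j x
        + ζ x ^ (2 * k + 2) * (pd (fun y => W y i) j x * caccA W Λ i j x)) := by
      have hdW : ∀ i, DifferentiableAt ℝ (fun y => W y i) x := fun i =>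
        ((hWi i).contDiffAt hn).differentiableAt (by simp)
      have hdA : ∀ i j, DifferentiableAt ℝ (caccA W Λ i j) x := fun i j =>
        ((cacc_A_smooth hW Λ i j).contDiffAt hn).differentiableAt (by simp)
      have hdζ : DifferentiableAt ℝ ζ x := hζs.differentiable (by simp) x
      have hpη : ∀ j, pd (fun y => ζ y ^ (2 * k + 2)) j x =
          2 * ((k : ℝ) + 1) * ζ x ^ (2 * k + 1) * pd ζ j x := by
        intro j
        unfold pd
        rw [fderiv_fun_pow _ hdζ]
        simp
        left; left; ring
      have hpW : ∀ i j, pd (fun y => W y i - b i) j x = pd (fun y => W y i) j x := by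
        intro i j
        unfold pd
        rw [fderiv_sub_const]
      have hterm : ∀ i j, pd (fun y => ζ y ^ (2 * k + 2) * ((W y i - b i) * caccA W Λ i j y)) j x
          = (2 * ((k : ℝ) + 1) * ζ x ^ (2 * k + 1) * pd ζ j x
        * (W x i - b i) * caccA W Λ i j x
        + ζ x ^ (2 * k + 2) * (pd (fun y => W y i) j x * caccA W Λ i j x))
        + ζ x ^ (2 * k + 2) * (W x i - b i) * pd (caccA W Λ i j) j x := by
        intro i j
        rw [cacc_pd_mul j (hdζ.fun_pow _) (((hdW i).sub_const _).fun_mul (hdA i j)),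
          cacc_pd_mul j ((hdW i).sub_const _) (hdA i j), hpη, hpW]
        ring
      rw [hD]
      refine Finset.sum_congr rfl fun i _ => ?_
      have hdiv := cacc_A_div hW Λ hx i (hpde x hx i)
      simp only [hterm]
      rw [Finset.sum_add_distrib, ← Finset.mul_sum, hdiv, mul_zero, add_zero]
    rw [hΛ, hV, hDx]
    exact hy
  have hint := setIntegral_mono_on hI1 ((hDi.const_mul 2).add (hI2.const_mul
    ((96 * ((k : ℝ) + 1) ^ 2 * K ^ 2) * (1 + ‖Λ‖ ^ 2)))) measurableSet_ball hpt
  rw [integral_add' (hDi.const_mul 2) (hI2.const_mul _), integral_const_mul, integral_const_mul,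
    hD0, mul_zero, zero_add] at hint
  refine hint.trans ?_
  have hnn : 0 ≤ ∫ x in ball (0 : E3) 1, ζ x ^ (2 * k) * ‖W x - b‖ ^ 2 :=
    integral_nonneg fun x => mul_nonneg (pow_nonneg (hζ0 x) _) (by positivity)
  gcongr
  linarith
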